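/- arXiv:1610.00898 — 7 statements merged into one kernel-verified Lean document; each statement's English description precedes it below -/
import Mathlib

section
/- Let G be a group equipped with a linear order < such that left multiplication preserves the order, and let a, b, t ∈ G satisfy the cable-knot relations a^x = b^y and t^p = μ^q * λ^p. Let m' and n' be integers with n' ≥ 1 and (p*q - 1)*n' ≤ m' ≤ p*q*n'. If μ_C^(m') * λ_C^(n') = 1, then a = 1, b = 1 and t = 1. (This expresses that for every rational r' = m'/n' ∈ [pq-1, pq], the fundamental group of r'-surgery on the (p,q)-cable of the (x,y)-torus knot is not left-orderable.) -/
theorem one_lt_zpow_of_mulLeftStrictMono {G : Type*} [Group G] [LinearOrder G]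
    [MulLeftStrictMono G] {g : G} (hg : 1 < g) {n : ℤ} (hn : 0 < n) : 1 < g ^ n := by
  have : MulLeftMono G := covariantClass_le_of_lt G G (· * ·)
  lift n to ℕ using hn.le
  rw [zpow_natCast]
  exact one_lt_pow' hg (by omega)

theorem one_lt_of_one_lt_zpow {G : Type*} [Group G] [LinearOrder G]
    [MulLeftStrictMono G] {g : G} {n : ℤ} (hn : 0 < n) (h : 1 < g ^ n) : 1 < g := by
  have : MulLeftMono G := covariantClass_le_of_lt G G (· * ·)
  lift n to ℕ using hn.le
  rw [zpow_natCast] at h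
  by_contra! hg
  exact absurd (pow_le_one' hg n) h.not_ge

theorem eq_one_of_zpow_eq_one {G : Type*} [Group G] [LinearOrder G]
    [MulLeftStrictMono G] {g : G} {n : ℤ} (hn : 0 < n) (h : g ^ n = 1) : g = 1 := by
  rcases lt_trichotomy g 1 with hg | hg | hg
  · have h1 : 1 < g⁻¹ := by simpa using mul_lt_mul_right hg g⁻¹
    have h2 := one_lt_zpow_of_mulLeftStrictMono h1 hn
    simp [h] at h2
  · exact hg
  · have h2 := one_lt_zpow_of_mulLeftStrictMono hg hn
    simp [h] at h2

/-- In a left-ordered group with `a ^ x = b ^ y` positive, the torus-knot meridian lies below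
the regular fibre. -/
theorem zpow_mul_zpow_lt_of_zpow_eq_zpow {G : Type*} [Group G] [LinearOrder G]
    [MulLeftStrictMono G] {a b : G} {x y i j : ℤ} (hy : 0 < y) (hj : j < 0) (hi : 0 < i)
    (hix : i < x) (hab : a ^ x = b ^ y) (h : 1 < a ^ x) : b ^ j * a ^ i < a ^ x := by
  have ha : 1 < a := one_lt_of_one_lt_zpow (hi.trans hix) h
  have hb : 1 < b := one_lt_of_one_lt_zpow hy (hab ▸ h)
  have h1 : a ^ i < a ^ x := by
    have := mul_lt_mul_right
      (one_lt_zpow_of_mulLeftStrictMono ha (sub_pos.2 hix)) (a ^ i)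
    rwa [← zpow_add, mul_one, add_sub_cancel] at this
  have h2 : a ^ x < b ^ (-j) * a ^ x := by
    have := mul_lt_mul_right
      (one_lt_zpow_of_mulLeftStrictMono hb (neg_pos.2 hj)) (b ^ y)
    rwa [← zpow_add, mul_one, add_comm, zpow_add, ← hab] at this
  simpa using mul_lt_mul_right (h1.trans h2) (b ^ j)

/-- If `w` commutes with a positive `z` and `w ^ k = z ^ n` with `0 ≤ k ≤ n`, `0 < n`,
then `z ≤ w`. -/
theorem le_of_zpow_eq_zpow_of_commute {G : Type*} [Group G] [LinearOrder G]
    [MulLeftStrictMono G] {w z : G} (hwz : Commute w z) (hz : 1 < z) {k n : ℤ}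
    (hk : 0 ≤ k) (hkn : k ≤ n) (hn : 0 < n) (h : w ^ k = z ^ n) : z ≤ w := by
  have hk : 0 < k := by
    rcases hk.eq_or_lt with rfl | hk
    · have := one_lt_zpow_of_mulLeftStrictMono hz hn
      rw [← h, zpow_zero] at this
      exact absurd this (lt_irrefl _)
    · exact hk
  by_contra! hlt
  have hd : 1 < w⁻¹ * z := by simpa using mul_lt_mul_right hlt w⁻¹
  have h1 := one_lt_zpow_of_mulLeftStrictMono hd hk
  rw [hwz.inv_left.mul_zpow, inv_zpow, h, ← zpow_neg, ← zpow_add] at h1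
  rcases hkn.eq_or_lt with rfl | hkn
  · simp at h1
  · have h2 := mul_lt_mul_right
      (one_lt_zpow_of_mulLeftStrictMono hz (sub_pos.2 hkn)) (z ^ (-n + k))
    rw [← zpow_add, mul_one] at h2
    simp only [show -n + k + (n - k) = 0 by ring, zpow_zero] at h2
    exact lt_asymm h1 h2

/-- If `h` commutes with `t ^ p` and `(h * t⁻¹) ^ k = t ^ (p * n)` with `t` positive, then `h`
is positive and `h ≤ h ^ p * t ^ (-p)`. -/
theorem le_zpow_mul_zpow_neg_of_surgery {G : Type*} [Group G] [LinearOrder G]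
    [MulLeftStrictMono G] {h t : G} {p k n : ℤ} (hp : 2 ≤ p) (hk : 0 ≤ k) (hkn : k ≤ n)
    (hn : 0 < n) (hcomm : Commute h (t ^ p)) (hs : (h * t⁻¹) ^ k = t ^ (p * n)) (ht : 1 < t) :
    1 < h ∧ h ≤ h ^ p * t ^ (-p) := by
  have hz : 1 < t ^ p := one_lt_zpow_of_mulLeftStrictMono ht (by omega)
  have hw : Commute (h * t⁻¹) (t ^ p) :=
    hcomm.mul_left ((Commute.refl t).zpow_right p).inv_left
  have hle := le_of_zpow_eq_zpow_of_commute hw hz hk hkn hn (by rw [hs, zpow_mul])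
  have hwt : h * t⁻¹ < h := by simpa using mul_lt_mul_right ht (h * t⁻¹)
  have hlt : t ^ p < h := hle.trans_lt hwt
  have hh : 1 < h := hz.trans hlt
  refine ⟨hh, ?_⟩
  have hd : 1 < (t ^ p)⁻¹ * h := by simpa using mul_lt_mul_right hlt (t ^ p)⁻¹
  have h1 : h ^ (p - 1) < h ^ p * t ^ (-p) := by
    have := mul_lt_mul_right hd (h ^ (p - 1))
    rwa [mul_one, ← hcomm.inv_right.eq, ← mul_assoc, ← zpow_add_one, sub_add_cancel,
      ← zpow_neg] at this
  have h2 : h ≤ h ^ (p - 1) := by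
    rcases hp.eq_or_lt with rfl | hp
    · simp
    · have := mul_lt_mul_right
        (one_lt_zpow_of_mulLeftStrictMono hh (show 0 < p - 2 by omega)) h
      rw [mul_one, ← zpow_one_add, show 1 + (p - 2) = p - 1 by ring] at this
      exact this.le
  exact h2.trans h1.le

/-- Under the cable surgery relations, neither `t` is positive, nor `t = 1` with `a ^ x`
positive. -/
theorem cable_surgery_not_pos {G : Type*} [Group G] [LinearOrder G]
    (hLO : ∀ g u v : G, u < v → g * u < g * v) {a b t : G} {x y i j p k n : ℤ}
    (hy : 0 < y) (hj : j < 0) (hi : 0 < i) (hix : i < x) (hp : 2 ≤ p) (hk : 0 ≤ k)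
    (hkn : k ≤ n) (hn : 0 < n) (hab : a ^ x = b ^ y) (hcomm : Commute (a ^ x) (t ^ p))
    (hmu : b ^ j * a ^ i = (a ^ x) ^ p * t ^ (-p))
    (hs : (a ^ x * t⁻¹) ^ k = t ^ (p * n)) :
    ¬ 1 < t ∧ (t = 1 → ¬ 1 < a ^ x) := by
  have : MulLeftStrictMono G := ⟨fun g _ _ huv => hLO g _ _ huv⟩
  constructor
  · intro ht
    obtain ⟨h1, h2⟩ := le_zpow_mul_zpow_neg_of_surgery hp hk hkn hn hcomm hs ht
    have h3 := zpow_mul_zpow_lt_of_zpow_eq_zpow hy hj hi hix hab h1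
    rw [hmu] at h3
    exact absurd h3 h2.not_gt
  · rintro rfl h1
    have h3 := zpow_mul_zpow_lt_of_zpow_eq_zpow hy hj hi hix hab h1
    rw [hmu, one_zpow, mul_one] at h3
    have h4 := mul_lt_mul_right
      (one_lt_zpow_of_mulLeftStrictMono h1 (show 0 < p - 1 by omega)) (a ^ x)
    rw [mul_one, ← zpow_one_add, add_sub_cancel] at h4
    exact lt_asymm h3 h4


/-- For every rational r' = m'/n' ∈ [pq-1, pq], the fundamental group of
r'-surgery on the (p,q)-cable of the (x,y)-torus knot is not left-orderable: in a
left-ordered group satisfying the cable-knot relations, the surgery relation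
μ_C^(m') * λ_C^(n') = 1 forces a = b = t = 1. -/
theorem stmt_0 {G : Type*} [Group G] [LinearOrder G]
    (hLO : ∀ g u v : G, u < v → g * u < g * v)
    (x y i j p q : ℤ) (hx : 2 ≤ x) (hy : 2 ≤ y) (hxy : Int.gcd x y = 1)
    (hij : x * j + y * i = 1) (hi : 0 < i) (hix : i < x)
    (hp : 2 ≤ p) (hq : q = p * x * y - 1)
    (a b t mu lam muC lamC : G)
    (hmu : mu = b ^ j * a ^ i)
    (hlam : lam = mu ^ (-(x * y)) * a ^ x)
    (hmuC : muC = mu ^ (x * y) * lam * t⁻¹)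
    (hlamC : lamC = muC ^ (-(p * q)) * t ^ p)
    (rel1 : a ^ x = b ^ y)
    (rel2 : t ^ p = mu ^ q * lam ^ p)
    (m' n' : ℤ) (hn' : 1 ≤ n')
    (hlow : (p * q - 1) * n' ≤ m') (hhigh : m' ≤ p * q * n')
    (hsurg : muC ^ m' * lamC ^ n' = 1) :
    a = 1 ∧ b = 1 ∧ t = 1 := by
  have hj : j < 0 := by
    by_contra! hj
    rcases hj.eq_or_lt with rfl | hj
    · nlinarith
    · nlinarith
  have hha : Commute (a ^ x) a := (Commute.refl a).zpow_left x
  have hhb : Commute (a ^ x) b := rel1 ▸ (Commute.refl b).zpow_left y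
  have hhmu : Commute (a ^ x) mu := by
    rw [hmu]; exact (hhb.zpow_right j).mul_right (hha.zpow_right i)
  have htp : t ^ p = mu⁻¹ * (a ^ x) ^ p := by
    rw [rel2, hlam, (hhmu.symm.zpow_left _).mul_zpow, ← zpow_mul, ← mul_assoc, ← zpow_add,
      ← zpow_neg_one, hq]
    congr 2
    ring
  have hcomm : Commute (a ^ x) (t ^ p) := by
    rw [htp]; exact hhmu.inv_right.mul_right ((Commute.refl _).zpow_right p)
  have hmuC' : muC = a ^ x * t⁻¹ := by
    rw [hmuC, hlam, ← mul_assoc, ← zpow_add, add_neg_cancel, zpow_zero, one_mul]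
  have hmu' : b ^ j * a ^ i = (a ^ x) ^ p * t ^ (-p) := by
    rw [← hmu, zpow_neg, htp]; group
  have hs : (a ^ x * t⁻¹) ^ (p * q * n' - m') = t ^ (p * n') := by
    have hw : Commute muC (t ^ p) := by
      rw [hmuC']
      exact hcomm.mul_left ((Commute.refl t).zpow_right p).inv_left
    rw [hlamC, (hw.zpow_left _).mul_zpow, ← zpow_mul, ← mul_assoc, ← zpow_add,
      ← zpow_mul] at hsurg
    rw [← hmuC', eq_inv_of_mul_eq_one_right hsurg, ← zpow_neg]
    congr 1
    ring
  have hk : 0 ≤ p * q * n' - m' := by linarith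
  have hkn : p * q * n' - m' ≤ n' := by linarith
  have pos := cable_surgery_not_pos hLO (by omega) hj hi hix hp hk hkn (by omega) rel1 hcomm
    hmu' hs
  have neg := cable_surgery_not_pos (G := Gᵒᵈ) (fun g u v huv => hLO g v u huv) (by omega) hj hi
    hix hp hk hkn (by omega) rel1 hcomm hmu' hs
  have ht : t = 1 := le_antisymm (not_lt.1 pos.1) (not_lt.1 neg.1)
  have hh : a ^ x = 1 := le_antisymm (not_lt.1 (pos.2 ht)) (not_lt.1 (neg.2 ht))
  have : MulLeftStrictMono G := ⟨fun g _ _ huv => hLO g _ _ huv⟩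
  exact ⟨eq_one_of_zpow_eq_one (by omega) hh, eq_one_of_zpow_eq_one (by omega) (rel1 ▸ hh), ht⟩
end

section
/- Let G be a group equipped with a linear order < such that left multiplication preserves the order, and let a, b, t ∈ G satisfy the cable-knot relations a^x = b^y and t^p = μ^q * λ^p. Let β ≥ 1 be an integer. If μ_C^(p*q*β - 1) * λ_C^(β) = 1, then a = 1, b = 1 and t = 1. (This expresses that the fundamental group of (pq - 1/β)-surgery on the (p,q)-cable of the (x,y)-torus knot is not left-orderable.) -/
section LeftOrdered

variable {G : Type*} [Group G] [LinearOrder G] [MulLeftMono G]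

theorem one_lt_zpow_iff_of_pos {g : G} {n : ℤ} (hn : 0 < n) : 1 < g ^ n ↔ 1 < g := by
  lift n to ℕ using hn.le
  rw [zpow_natCast]
  exact one_lt_pow_iff (by omega)

theorem zpow_eq_one_iff_of_pos {g : G} {n : ℤ} (hn : 0 < n) : g ^ n = 1 ↔ g = 1 := by
  refine ⟨fun h => ?_, fun h => by rw [h, one_zpow]⟩
  refine le_antisymm (not_lt.1 fun hg => ?_) (not_lt.1 fun hg => ?_)
  · exact ((one_lt_zpow_iff_of_pos hn).2 hg).ne' h
  · exact ((one_lt_zpow_iff_of_pos (G := Gᵒᵈ) hn).2 hg).ne' h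

/-- If positive powers of `a`, `b`, `t` all equal `h`, then `a`, `b`, `t` have the same sign as
`h`, so a product of positive powers of them is trivial only when `h` is not positive. -/
theorem not_one_lt_of_zpow_mul_zpow_mul_zpow_eq_one {a b t h : G} {k l m r s u : ℤ}
    (hk : 0 < k) (hl : 0 < l) (hm : 0 < m) (hr : 0 < r) (hs : 0 < s) (hu : 0 < u)
    (ha : a ^ k = h) (hb : b ^ l = h) (ht : t ^ m = h)
    (hprod : a ^ r * b ^ s * t ^ u = 1) : ¬ 1 < h := by
  intro hh
  have ha' : 1 < a ^ r :=
    (one_lt_zpow_iff_of_pos hr).2 ((one_lt_zpow_iff_of_pos hk).1 (ha ▸ hh))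
  have hb' : 1 < b ^ s :=
    (one_lt_zpow_iff_of_pos hs).2 ((one_lt_zpow_iff_of_pos hl).1 (hb ▸ hh))
  have ht' : 1 < t ^ u :=
    (one_lt_zpow_iff_of_pos hu).2 ((one_lt_zpow_iff_of_pos hm).1 (ht ▸ hh))
  exact (one_lt_mul' (one_lt_mul' ha' hb') ht').ne' hprod

theorem eq_one_of_zpow_mul_zpow_mul_zpow_eq_one {a b t h : G} {k l m r s u : ℤ}
    (hk : 0 < k) (hl : 0 < l) (hm : 0 < m) (hr : 0 < r) (hs : 0 < s) (hu : 0 < u)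
    (ha : a ^ k = h) (hb : b ^ l = h) (ht : t ^ m = h)
    (hprod : a ^ r * b ^ s * t ^ u = 1) : a = 1 ∧ b = 1 ∧ t = 1 := by
  have hpos : ¬ 1 < h :=
    not_one_lt_of_zpow_mul_zpow_mul_zpow_eq_one hk hl hm hr hs hu ha hb ht hprod
  have hneg : ¬ h < 1 :=
    not_one_lt_of_zpow_mul_zpow_mul_zpow_eq_one (G := Gᵒᵈ) hk hl hm hr hs hu ha hb ht hprod
  obtain rfl : h = 1 := le_antisymm (not_lt.1 hpos) (not_lt.1 hneg)
  exact ⟨(zpow_eq_one_iff_of_pos hk).1 ha, (zpow_eq_one_iff_of_pos hl).1 hb,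
    (zpow_eq_one_iff_of_pos hm).1 ht⟩

end LeftOrdered

/-- In the surgered cable group, the regular fibre `a ^ x` of the torus knot and the torus knot
meridian `mu` are both powers of `t`. -/
theorem fibre_and_meridian_eq_zpow {G : Type*} [Group G]
    {x y p q β : ℤ} (hq : q = p * x * y - 1)
    {a t mu lam muC lamC : G} (hcomm : Commute mu (a ^ x))
    (hlam : lam = mu ^ (-(x * y)) * a ^ x)
    (hmuC : muC = mu ^ (x * y) * lam * t⁻¹)
    (hlamC : lamC = muC ^ (-(p * q)) * t ^ p)
    (rel : t ^ p = mu ^ q * lam ^ p)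
    (hsurg : muC ^ (p * q * β - 1) * lamC ^ β = 1) :
    a ^ x = t ^ (p * β + 1) ∧ mu = t ^ (p * p * β) := by
  generalize a ^ x = h at *
  have htp : t ^ p = mu⁻¹ * h ^ p := by
    rw [rel, hlam, (hcomm.zpow_left _).mul_zpow, ← mul_assoc, ← zpow_mul, ← zpow_add, hq,
      ← zpow_neg_one]
    congr 2
    ring
  have hmuC' : muC = h * t⁻¹ := by
    rw [hmuC, hlam, ← mul_assoc, ← zpow_add]
    simp
  have hth : Commute (t ^ p) h := by
    rw [htp]
    exact hcomm.inv_left.mul_left ((Commute.refl h).zpow_left p)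
  have htm : Commute muC (t ^ p) := by
    rw [hmuC']
    exact hth.symm.mul_left ((Commute.refl t).zpow_right p).inv_left
  have hmuCt : muC = t ^ (p * β) := by
    rw [hlamC, (htm.zpow_left _).mul_zpow, ← mul_assoc, ← zpow_mul, ← zpow_mul, ← zpow_add,
      show p * q * β - 1 + -(p * q) * β = -1 by ring, zpow_neg_one] at hsurg
    exact inv_mul_eq_one.1 hsurg
  have hh : h = t ^ (p * β + 1) := by
    rw [zpow_add_one, ← hmuCt, hmuC', inv_mul_cancel_right]
  refine ⟨hh, ?_⟩
  have hmu : mu = h ^ p * (t ^ p)⁻¹ := by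
    rw [htp, mul_inv_rev, inv_inv, mul_inv_cancel_left]
  rw [hmu, hh, ← zpow_mul, ← zpow_neg, ← zpow_add]
  congr 1
  ring

/-- The fundamental group of (pq - 1/β)-surgery on the (p,q)-cable of the
(x,y)-torus knot is not left-orderable: in a left-ordered group satisfying the cable-knot
relations, the surgery relation μ_C^(pqβ - 1) * λ_C^β = 1 forces a = b = t = 1. -/
theorem stmt_1 {G : Type*} [Group G] [LinearOrder G]
    (hLO : ∀ g u v : G, u < v → g * u < g * v)
    (x y i j p q : ℤ) (hx : 2 ≤ x) (hy : 2 ≤ y) (hxy : Int.gcd x y = 1)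
    (hij : x * j + y * i = 1) (hi : 0 < i) (hix : i < x)
    (hp : 2 ≤ p) (hq : q = p * x * y - 1)
    (a b t mu lam muC lamC : G)
    (hmu : mu = b ^ j * a ^ i)
    (hlam : lam = mu ^ (-(x * y)) * a ^ x)
    (hmuC : muC = mu ^ (x * y) * lam * t⁻¹)
    (hlamC : lamC = muC ^ (-(p * q)) * t ^ p)
    (rel1 : a ^ x = b ^ y)
    (rel2 : t ^ p = mu ^ q * lam ^ p)
    (β : ℤ) (hβ : 1 ≤ β)
    (hsurg : muC ^ (p * q * β - 1) * lamC ^ β = 1) :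
    a = 1 ∧ b = 1 ∧ t = 1 := by
  have : MulLeftMono G :=
    ⟨fun g u v huv => huv.eq_or_lt.elim (fun e => e ▸ le_rfl) fun l => (hLO g u v l).le⟩
  have hac : Commute a (a ^ x) := (Commute.refl a).zpow_right x
  have hbc : Commute b (a ^ x) := rel1 ▸ (Commute.refl b).zpow_right y
  have hcomm : Commute mu (a ^ x) := hmu ▸ (hbc.zpow_left j).mul_left (hac.zpow_left i)
  obtain ⟨hfib, hmer⟩ := fibre_and_meridian_eq_zpow hq hcomm hlam hmuC hlamC rel2 hsurg
  have hj : j < 0 := by nlinarith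
  have hu : 0 < p * p * β - (p * β + 1) := by
    nlinarith [mul_le_mul hp hβ (by norm_num) (by linarith)]
  have hrel : b ^ j * a ^ i = a ^ x * t ^ (p * p * β - (p * β + 1)) := by
    rw [← hmu, hmer, hfib, ← zpow_add]
    congr 1
    ring
  have hai : a ^ i = a ^ x * (b ^ (-j) * t ^ (p * p * β - (p * β + 1))) := by
    rw [← mul_assoc, ← (hbc.zpow_left (-j)).eq, mul_assoc, ← hrel, zpow_neg,
      inv_mul_cancel_left]
  refine eq_one_of_zpow_mul_zpow_mul_zpow_eq_one (by omega) (by omega) (by positivity)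
    (sub_pos.2 hix) (neg_pos.2 hj) hu rfl rel1.symm hfib.symm ?_
  rw [mul_assoc, sub_eq_neg_add, zpow_add, mul_assoc, ← hai, zpow_neg, inv_mul_cancel]
end

section
/- Let G be a group equipped with a linear order < such that left multiplication preserves the order, and let M, L ∈ G be commuting elements. Let m0, n0, m1, n1, m, n be integers with n0 ≥ 1, n1 ≥ 1, n ≥ 1, m0*n < m*n0, and m*n1 < m1*n (i.e., m0/n0 < m/n < m1/n1). If M^(m0) * L^(n0) and M^(m1) * L^(n1) have the same sign, then M^m * L^n has that same sign as well; explicitly: if both are > 1 then M^m * L^n > 1, if both are < 1 then M^m * L^n < 1, and if both equal 1 then M^m * L^n = 1. -/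
section LeftOrdered

variable {G : Type*} [Group G] [LinearOrder G]

theorem one_lt_zpow_of_left_ordered (hLO : ∀ g u v : G, u < v → g * u < g * v)
    {x : G} (hx : 1 < x) {k : ℤ} (hk : 1 ≤ k) : 1 < x ^ k := by
  induction k, hk using Int.leInduction with
  | base => simpa using hx
  | succ k _ ih =>
    rw [zpow_add_one]
    exact ih.trans (by simpa using hLO (x ^ k) 1 x hx)

theorem zpow_lt_one_of_left_ordered (hLO : ∀ g u v : G, u < v → g * u < g * v)
    {x : G} (hx : x < 1) {k : ℤ} (hk : 1 ≤ k) : x ^ k < 1 := by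
  induction k, hk using Int.leInduction with
  | base => simpa using hx
  | succ k _ ih =>
    rw [zpow_add_one]
    exact lt_trans (by simpa using hLO (x ^ k) x 1 hx) ih

end LeftOrdered

theorem Commute.mul_zpow_mul_zpow {G : Type*} [Group G] {M L : G} (h : Commute M L)
    (p q k : ℤ) : (M ^ p * L ^ q) ^ k = M ^ (p * k) * L ^ (q * k) := by
  rw [(h.zpow_zpow p q).mul_zpow, zpow_mul, zpow_mul]

/-- In a left-ordered group, if M and L commute and
m0/n0 < m/n < m1/n1 (with n0, n1, n ≥ 1), then M^m * L^n has the same sign as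
M^(m0) * L^(n0) and M^(m1) * L^(n1) whenever those two have the same sign. -/
theorem stmt_3 {G : Type*} [Group G] [LinearOrder G]
    (hLO : ∀ g u v : G, u < v → g * u < g * v)
    (M L : G) (hML : M * L = L * M)
    (m0 n0 m1 n1 m n : ℤ)
    (hn0 : 1 ≤ n0) (hn1 : 1 ≤ n1) (hn : 1 ≤ n)
    (h01 : m0 * n < m * n0) (h12 : m * n1 < m1 * n) :
    (1 < M ^ m0 * L ^ n0 → 1 < M ^ m1 * L ^ n1 → 1 < M ^ m * L ^ n) ∧
    (M ^ m0 * L ^ n0 < 1 → M ^ m1 * L ^ n1 < 1 → M ^ m * L ^ n < 1) ∧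
    (M ^ m0 * L ^ n0 = 1 → M ^ m1 * L ^ n1 = 1 → M ^ m * L ^ n = 1) := by
  have hc : Commute M L := hML
  have ha : 1 ≤ m1 * n - m * n1 := by linarith
  have hb : 1 ≤ m * n0 - m0 * n := by linarith
  have hD : 1 ≤ m1 * n0 - m0 * n1 := by
    have : 0 < (m1 * n0 - m0 * n1) * n := by nlinarith
    exact pos_of_mul_pos_left this (by linarith)
  have key : (M ^ m0 * L ^ n0) ^ (m1 * n - m * n1) * (M ^ m1 * L ^ n1) ^ (m * n0 - m0 * n) =
      (M ^ m * L ^ n) ^ (m1 * n0 - m0 * n1) := by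
    simp only [hc.mul_zpow_mul_zpow]
    rw [((hc.zpow_zpow _ _).symm).mul_mul_mul_comm, ← zpow_add, ← zpow_add]
    congr 2 <;> ring
  have pos : ∀ {x : G}, 1 < x → ∀ {k : ℤ}, 1 ≤ k → 1 < x ^ k :=
    fun hx _ hk => one_lt_zpow_of_left_ordered hLO hx hk
  have neg : ∀ {x : G}, x < 1 → ∀ {k : ℤ}, 1 ≤ k → x ^ k < 1 :=
    fun hx _ hk => zpow_lt_one_of_left_ordered hLO hx hk
  refine ⟨fun h0 h1 => ?_, fun h0 h1 => ?_, fun h0 h1 => ?_⟩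
  · have hZ : 1 < (M ^ m * L ^ n) ^ (m1 * n0 - m0 * n1) := by
      rw [← key]
      exact (pos h0 ha).trans (by simpa using hLO _ _ _ (pos h1 hb))
    by_contra hle
    rcases (not_lt.mp hle).lt_or_eq with h | h
    · exact lt_asymm hZ (neg h hD)
    · simp [h] at hZ
  · have hZ : (M ^ m * L ^ n) ^ (m1 * n0 - m0 * n1) < 1 := by
      rw [← key]
      exact lt_trans (by simpa using hLO _ _ _ (neg h1 hb)) (neg h0 ha)
    by_contra hle
    rcases (not_lt.mp hle).lt_or_eq with h | h
    · exact lt_asymm hZ (pos h hD)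
    · simp [← h] at hZ
  · rw [h0, h1, one_zpow, one_zpow, one_mul] at key
    rcases lt_trichotomy (M ^ m * L ^ n) 1 with h | h | h
    · exact absurd key.symm (neg h hD).ne
    · exact h
    · exact absurd key.symm (pos h hD).ne'
end

section
/- Let G be a group, let x, y, i, j, p, q, u, v be integers with p ≥ 1 and p*u - q*v = 1, and let a, b, t ∈ G satisfy a^x = b^y and t^p = μ^q * λ^p, where μ := b^j * a^i and λ := μ^(-x*y) * a^x. Define μ_C := μ^u * λ^v * t^(-v) and λ_C := μ_C^(-p*q) * t^p. If β ≥ 1 is an integer and μ_C^(p*q*β - 1) * λ_C^(β) = 1, then t^(p*β + v) = μ^u * λ^v. -/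
/-- In any group with the cable-knot relations (general u, v with
p*u - q*v = 1 and p ≥ 1), the surgery relation μ_C^(pqβ - 1) * λ_C^β = 1 for an integer
β ≥ 1 implies t^(pβ + v) = μ^u * λ^v. -/
theorem stmt_7 {G : Type*} [Group G]
    (x y i j p q u v : ℤ) (hp : 1 ≤ p) (huv : p * u - q * v = 1)
    (a b t mu lam muC lamC : G)
    (hmu : mu = b ^ j * a ^ i)
    (hlam : lam = mu ^ (-(x * y)) * a ^ x)
    (hmuC : muC = mu ^ u * lam ^ v * t ^ (-v))
    (hlamC : lamC = muC ^ (-(p * q)) * t ^ p)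
    (rel1 : a ^ x = b ^ y)
    (rel2 : t ^ p = mu ^ q * lam ^ p)
    (β : ℤ) (hβ : 1 ≤ β)
    (hsurg : muC ^ (p * q * β - 1) * lamC ^ β = 1) :
    t ^ (p * β + v) = mu ^ u * lam ^ v := by
  have ha : Commute (a ^ x) a := Commute.zpow_self a x
  have hb : Commute (a ^ x) b := rel1 ▸ Commute.zpow_self b y
  have hax : Commute (a ^ x) mu :=
    hmu ▸ (hb.zpow_right j).mul_right (ha.zpow_right i)
  have hml : Commute mu lam :=
    hlam ▸ ((Commute.refl mu).zpow_right _).mul_right hax.symm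
  have htm : Commute (t ^ p) mu :=
    rel2 ▸ ((Commute.refl mu).zpow_left q).mul_left (hml.symm.zpow_left p)
  have htl : Commute (t ^ p) lam :=
    rel2 ▸ (hml.zpow_left q).mul_left ((Commute.refl lam).zpow_left p)
  have htC : Commute (t ^ p) muC :=
    hmuC ▸ ((htm.zpow_right u).mul_right (htl.zpow_right v)).mul_right
      ((Commute.zpow_self t p).zpow_right _)
  have hC : t ^ (p * β) = muC := by
    rw [hlamC, (htC.symm.zpow_left _).mul_zpow, ← zpow_mul, ← zpow_mul, ← mul_assoc,
      ← zpow_add, show p * q * β - 1 + -(p * q) * β = -1 by ring, zpow_neg_one] at hsurg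
    exact (inv_mul_eq_one.mp hsurg).symm
  rw [zpow_add, hC, hmuC, zpow_neg, inv_mul_cancel_right]
end

section
/- Let G be a group and let a, b, t ∈ G satisfy the cable-knot relations a^x = b^y and t^p = μ^q * λ^p. Let β ≥ 1 be an integer and suppose μ_C^(p*q*β - 1) * λ_C^(β) = 1. Then t^(p*β + 1) = a^x = b^y, and t^(-(p*(β-1) + 1)) = a^((p-1)*x - i) * b^(-j). -/
/-- In a group satisfying the cable-knot relations, if β ≥ 1 and
μ_C^(pqβ - 1) * λ_C^β = 1, then t^(pβ + 1) = a^x = b^y and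
t^(-(p(β-1) + 1)) = a^((p-1)x - i) * b^(-j). -/
theorem stmt_8 {G : Type*} [Group G]
    (x y i j p q : ℤ) (hx : 2 ≤ x) (hy : 2 ≤ y) (hxy : Int.gcd x y = 1)
    (hij : x * j + y * i = 1) (hi : 0 < i) (hix : i < x)
    (hp : 2 ≤ p) (hq : q = p * x * y - 1)
    (a b t mu lam muC lamC : G)
    (hmu : mu = b ^ j * a ^ i)
    (hlam : lam = mu ^ (-(x * y)) * a ^ x)
    (hmuC : muC = mu ^ (x * y) * lam * t⁻¹)
    (hlamC : lamC = muC ^ (-(p * q)) * t ^ p)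
    (rel1 : a ^ x = b ^ y)
    (rel2 : t ^ p = mu ^ q * lam ^ p)
    (β : ℤ) (hβ : 1 ≤ β)
    (hsurg : muC ^ (p * q * β - 1) * lamC ^ β = 1) :
    t ^ (p * β + 1) = a ^ x ∧ t ^ (p * β + 1) = b ^ y ∧
    t ^ (-(p * (β - 1) + 1)) = a ^ ((p - 1) * x - i) * b ^ (-j) := by
  have hcomm_a : Commute (a ^ x) a := (Commute.refl a).zpow_left x
  have hcomm_b : Commute (a ^ x) b := rel1 ▸ (Commute.refl b).zpow_left y
  have hcomm_mu : Commute (a ^ x) mu :=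
    hmu ▸ (hcomm_b.zpow_right j).mul_right (hcomm_a.zpow_right i)
  have ht : t ^ p = mu⁻¹ * (a ^ x) ^ p := by
    rw [rel2, hlam, ((hcomm_mu.zpow_right _).symm).mul_zpow, ← zpow_mul mu, ← mul_assoc,
      ← zpow_add, ← zpow_neg_one mu]
    congr 2
    rw [hq]
    ring
  have hcomm_t : Commute (a ^ x) (t ^ p) :=
    ht ▸ hcomm_mu.inv_right.mul_right ((Commute.refl (a ^ x)).zpow_right p)
  have hmuC' : muC = a ^ x * t⁻¹ := by
    rw [hmuC, hlam, ← mul_assoc, ← zpow_add, add_neg_cancel, zpow_zero, one_mul]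
  have hcomm_muC : Commute muC (t ^ p) :=
    hmuC' ▸ hcomm_t.mul_left ((Commute.refl t).zpow_right p).inv_left
  have hmuC_eq : muC = t ^ (p * β) := by
    rw [hlamC, (hcomm_muC.zpow_left _).mul_zpow, ← zpow_mul, ← zpow_mul, ← mul_assoc,
      ← zpow_add, show p * q * β - 1 + -(p * q) * β = -1 by ring, zpow_neg_one,
      inv_mul_eq_one] at hsurg
    exact hsurg
  have key : t ^ (p * β + 1) = a ^ x := by
    rw [zpow_add_one, ← hmuC_eq, hmuC', inv_mul_cancel_right]
  refine ⟨key, key.trans rel1, ?_⟩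
  calc t ^ (-(p * (β - 1) + 1)) = (t ^ (p * β + 1))⁻¹ * t ^ p := by
        rw [← zpow_neg, ← zpow_add]
        congr 1
        ring
    _ = (a ^ x) ^ (p - 1) * mu⁻¹ := by
        rw [key, ht, ((hcomm_mu.inv_right.zpow_left p).symm).eq, ← mul_assoc, ← zpow_neg_one,
          ← zpow_add, neg_add_eq_sub]
    _ = a ^ ((p - 1) * x - i) * b ^ (-j) := by
        rw [hmu, mul_inv_rev, ← zpow_neg, ← zpow_neg, ← zpow_mul, ← mul_assoc, ← zpow_add,
          mul_comm x, ← sub_eq_add_neg]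
end

section
/- Let G be a group and let a, b, t ∈ G satisfy the cable-knot relations a^x = b^y and t^p = μ^q * λ^p. Then μ_C^(p*q - 1) * λ_C = t * a^(x*(p-1) - i) * b^(-j). -/
/-- In a group satisfying the cable-knot relations,
μ_C^(pq - 1) * λ_C = t * a^(x(p-1) - i) * b^(-j). -/
theorem stmt_9 {G : Type*} [Group G]
    (x y i j p q : ℤ) (hx : 2 ≤ x) (hy : 2 ≤ y) (hxy : Int.gcd x y = 1)
    (hij : x * j + y * i = 1) (hi : 0 < i) (hix : i < x)
    (hp : 2 ≤ p) (hq : q = p * x * y - 1)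
    (a b t mu lam muC lamC : G)
    (hmu : mu = b ^ j * a ^ i)
    (hlam : lam = mu ^ (-(x * y)) * a ^ x)
    (hmuC : muC = mu ^ (x * y) * lam * t⁻¹)
    (hlamC : lamC = muC ^ (-(p * q)) * t ^ p)
    (rel1 : a ^ x = b ^ y)
    (rel2 : t ^ p = mu ^ q * lam ^ p) :
    muC ^ (p * q - 1) * lamC = t * a ^ (x * (p - 1) - i) * b ^ (-j) := by
  have hab : Commute (a ^ x) b := rel1 ▸ (Commute.refl b).zpow_left y
  have haa : Commute (a ^ x) a := (Commute.refl a).zpow_left x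
  have hamu : Commute (a ^ x) mu := by
    rw [hmu]
    exact (hab.zpow_right j).mul_right (haa.zpow_right i)
  have h_muC : muC = a ^ x * t⁻¹ := by
    rw [hmuC, hlam, ← mul_assoc, ← zpow_add, add_neg_cancel, zpow_zero, one_mul]
  have h_tp : t ^ p = mu⁻¹ * a ^ (x * p) := by
    rw [rel2, hlam, (hamu.zpow_right _).symm.mul_zpow, ← zpow_mul, ← zpow_mul, ← mul_assoc,
      ← zpow_add, show q + -(x * y) * p = -1 by rw [hq]; ring, zpow_neg_one]
  have h_comm : Commute (b ^ (-j)) (a ^ (x * p)) := by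
    rw [zpow_mul]
    exact ((hab.zpow_right (-j)).zpow_left p).symm
  have h_left : muC ^ (p * q - 1) * lamC = t * a ^ (-x) * t ^ p := by
    rw [hlamC, ← mul_assoc, ← zpow_add, show p * q - 1 + -(p * q) = -1 by ring, zpow_neg_one,
      h_muC, mul_inv_rev, inv_inv, zpow_neg]
  calc muC ^ (p * q - 1) * lamC
      = t * a ^ (-x) * (a ^ (-i) * (b ^ (-j) * a ^ (x * p))) := by
        rw [h_left, h_tp, hmu, mul_inv_rev, ← zpow_neg, ← zpow_neg, mul_assoc (a ^ (-i))]
    _ = t * (a ^ (-x) * a ^ (-i) * a ^ (x * p)) * b ^ (-j) := by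
        rw [h_comm.eq]
        simp only [mul_assoc]
    _ = t * a ^ (x * (p - 1) - i) * b ^ (-j) := by
        rw [← zpow_add, ← zpow_add, show -x + -i + x * p = x * (p - 1) - i by ring]
end

section
/- Let G be a group equipped with a linear order < such that left multiplication preserves the order, and let a, b, t ∈ G satisfy the cable-knot relations a^x = b^y and t^p = μ^q * λ^p. Then μ_C^(p*q - 1) * λ_C has the same sign as t; explicitly: 1 < t ↔ 1 < μ_C^(p*q - 1) * λ_C, and t < 1 ↔ μ_C^(p*q - 1) * λ_C < 1. -/
lemma mulClosed_zpow_mul {G : Type*} [Group G] {P : G → Prop}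
    (hP : ∀ u v, P u → P v → P (u * v))
    {g v : G} (hg : P g) (hv : P v) {n : ℤ} (hn : 0 ≤ n) :
    P (g ^ n * v) := by
  induction n, hn using Int.leInduction with
  | base => simpa using hv
  | succ n _ ih =>
    rw [add_comm, zpow_add, zpow_one, mul_assoc]
    exact hP _ _ hg ih

lemma mulClosed_zpow {G : Type*} [Group G] {P : G → Prop}
    (hP : ∀ u v, P u → P v → P (u * v))
    {g : G} (hg : P g) {n : ℤ} (hn : 0 < n) : P (g ^ n) := by
  have h := mulClosed_zpow_mul hP hg hg (n := n - 1) (by omega)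
  rwa [← zpow_add_one, sub_add_cancel] at h

lemma leftOrdered_one_lt_mul {G : Type*} [Group G] [LinearOrder G]
    (hLO : ∀ g u v : G, u < v → g * u < g * v)
    (u v : G) (hu : 1 < u) (hv : 1 < v) : 1 < u * v :=
  hu.trans (by simpa using hLO u 1 v hv)

lemma leftOrdered_mul_lt_one {G : Type*} [Group G] [LinearOrder G]
    (hLO : ∀ g u v : G, u < v → g * u < g * v)
    (u v : G) (hu : u < 1) (hv : v < 1) : u * v < 1 :=
  lt_trans (by simpa using hLO u v 1 hv) hu

lemma leftOrdered_one_lt_of_zpow {G : Type*} [Group G] [LinearOrder G]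
    (hLO : ∀ g u v : G, u < v → g * u < g * v)
    {g : G} {n : ℤ} (hn : 0 < n) (h : 1 < g ^ n) : 1 < g := by
  rcases lt_trichotomy 1 g with hg | rfl | hg
  · exact hg
  · simp at h
  · exact absurd (mulClosed_zpow (P := (· < 1)) (leftOrdered_mul_lt_one hLO) hg hn) h.asymm

lemma leftOrdered_lt_one_of_zpow {G : Type*} [Group G] [LinearOrder G]
    (hLO : ∀ g u v : G, u < v → g * u < g * v)
    {g : G} {n : ℤ} (hn : 0 < n) (h : g ^ n < 1) : g < 1 := by
  rcases lt_trichotomy 1 g with hg | rfl | hg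
  · exact absurd (mulClosed_zpow (P := (1 < ·)) (leftOrdered_one_lt_mul hLO) hg hn) h.asymm
  · simp at h
  · exact hg

lemma leftOrdered_eq_one_of_zpow {G : Type*} [Group G] [LinearOrder G]
    (hLO : ∀ g u v : G, u < v → g * u < g * v)
    {g : G} {n : ℤ} (hn : 0 < n) (h : g ^ n = 1) : g = 1 := by
  rcases lt_trichotomy 1 g with hg | hg | hg
  · exact absurd h (mulClosed_zpow (P := (1 < ·)) (leftOrdered_one_lt_mul hLO) hg hn).ne'
  · exact hg.symm
  · exact absurd h (mulClosed_zpow (P := (· < 1)) (leftOrdered_mul_lt_one hLO) hg hn).ne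

/-- The cable relation, solved for `t ^ p` in terms of the central element `a ^ x` of the
torus knot group. -/
lemma cable_zpow_eq {G : Type*} [Group G] {x y i j p q : ℤ} (hq : q = p * x * y - 1)
    {a b t mu lam : G} (hmu : mu = b ^ j * a ^ i) (hlam : lam = mu ^ (-(x * y)) * a ^ x)
    (rel1 : a ^ x = b ^ y) (rel2 : t ^ p = mu ^ q * lam ^ p) :
    t ^ p = (a ^ x) ^ (p - 1) * (a ^ (x - i) * b ^ (-j)) := by
  have hcb : Commute (a ^ x) (b ^ j) := by
    rw [rel1]; exact (Commute.refl b).zpow_zpow y j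
  have hc : Commute (a ^ x) mu := by
    rw [hmu]; exact hcb.mul_right ((Commute.refl a).zpow_zpow x i)
  have hfactor : a ^ (x - i) * b ^ (-j) = a ^ x * mu⁻¹ := by
    rw [hmu, mul_inv_rev, zpow_sub, zpow_neg, mul_assoc]
  rw [rel2, hlam, (hc.symm.zpow_left _).mul_zpow, ← zpow_mul, ← mul_assoc, ← zpow_add,
    show q + -(x * y) * p = -1 by rw [hq]; ring, zpow_neg_one, hfactor, ← mul_assoc,
    ← zpow_add_one, sub_add_cancel]
  exact (hc.symm.inv_left.zpow_right p).eq

lemma cable_slope_eq {G : Type*} [Group G] {x y p q : ℤ} {a t mu lam muC lamC : G}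
    (hlam : lam = mu ^ (-(x * y)) * a ^ x) (hmuC : muC = mu ^ (x * y) * lam * t⁻¹)
    (hlamC : lamC = muC ^ (-(p * q)) * t ^ p) :
    muC ^ (p * q - 1) * lamC = t * ((a ^ x)⁻¹ * t ^ p) := by
  have h : muC = a ^ x * t⁻¹ := by
    rw [hmuC, hlam, zpow_neg, mul_inv_cancel_left]
  rw [hlamC, ← mul_assoc, ← zpow_add, show p * q - 1 + -(p * q) = -1 by ring, zpow_neg_one, h,
    mul_inv_rev, inv_inv, mul_assoc]


/-- In a left-ordered group satisfying the cable-knot relations,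
μ_C^(pq - 1) * λ_C has the same sign as t. -/
theorem stmt_10 {G : Type*} [Group G] [LinearOrder G]
    (hLO : ∀ g u v : G, u < v → g * u < g * v)
    (x y i j p q : ℤ) (hx : 2 ≤ x) (hy : 2 ≤ y) (hxy : Int.gcd x y = 1)
    (hij : x * j + y * i = 1) (hi : 0 < i) (hix : i < x)
    (hp : 2 ≤ p) (hq : q = p * x * y - 1)
    (a b t mu lam muC lamC : G)
    (hmu : mu = b ^ j * a ^ i)
    (hlam : lam = mu ^ (-(x * y)) * a ^ x)
    (hmuC : muC = mu ^ (x * y) * lam * t⁻¹)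
    (hlamC : lamC = muC ^ (-(p * q)) * t ^ p)
    (rel1 : a ^ x = b ^ y)
    (rel2 : t ^ p = mu ^ q * lam ^ p) :
    (1 < t ↔ 1 < muC ^ (p * q - 1) * lamC) ∧ (t < 1 ↔ muC ^ (p * q - 1) * lamC < 1) := by
  have hj : 0 < -j := by
    have : x * j < 0 := by nlinarith
    nlinarith
  have htp := cable_zpow_eq hq hmu hlam rel1 rel2
  have hw : muC ^ (p * q - 1) * lamC =
      t * ((a ^ x) ^ (p - 2) * (a ^ (x - i) * b ^ (-j))) := by
    rw [cable_slope_eq hlam hmuC hlamC, htp, ← mul_assoc (a ^ x)⁻¹, ← zpow_neg_one (a ^ x),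
      ← zpow_add, show -1 + (p - 1) = p - 2 by ring]
  have key : ∀ P : G → Prop, (∀ u v, P u → P v → P (u * v)) → P a → P b → (P (t ^ p) → P t) →
      P t ∧ P (muC ^ (p * q - 1) * lamC) := by
    intro P hP ha hb ht
    have hax := mulClosed_zpow hP ha (n := x) (by omega)
    have hab := hP _ _ (mulClosed_zpow hP ha (n := x - i) (by omega)) (mulClosed_zpow hP hb hj)
    have ht' : P t := ht (htp ▸ mulClosed_zpow_mul hP hax hab (by omega))
    exact ⟨ht', hw ▸ hP _ _ ht' (mulClosed_zpow_mul hP hax hab (by omega))⟩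
  rcases lt_trichotomy 1 a with ha | ha | ha
  · have hb : 1 < b := leftOrdered_one_lt_of_zpow hLO (n := y) (by omega)
      (rel1 ▸ mulClosed_zpow (P := (1 < ·)) (leftOrdered_one_lt_mul hLO) ha (by omega))
    obtain ⟨ht, hs⟩ := key (1 < ·) (leftOrdered_one_lt_mul hLO) ha hb
      (leftOrdered_one_lt_of_zpow hLO (by omega))
    exact ⟨iff_of_true ht hs, iff_of_false ht.asymm hs.asymm⟩
  · subst ha
    obtain rfl : b = 1 := leftOrdered_eq_one_of_zpow hLO (n := y) (by omega)
      (by simpa using rel1.symm)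
    obtain rfl : t = 1 := leftOrdered_eq_one_of_zpow hLO (n := p) (by omega) (by simpa using htp)
    simp [hw]
  · have hb : b < 1 := leftOrdered_lt_one_of_zpow hLO (n := y) (by omega)
      (rel1 ▸ mulClosed_zpow (P := (· < 1)) (leftOrdered_mul_lt_one hLO) ha (by omega))
    obtain ⟨ht, hs⟩ := key (· < 1) (leftOrdered_mul_lt_one hLO) ha hb
      (leftOrdered_lt_one_of_zpow hLO (by omega))
    exact ⟨iff_of_false ht.asymm hs.asymm, iff_of_true ht hs⟩
end
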